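/- There exists m₀ > e^e such that for every real number m ≥ m₀ and every killing rate κ > 0 satisfying exp(e^{32}) ≤ κ^{−1} ≤ m^{1 − 8/(log log m)}, one has κ^{−1} ≤ m^{1 − 6/(log G^{o,o})}. (Under these hypotheses G^{o,o} > 1, so log G^{o,o} > 0.) -/

import Mathlib

open scoped Real

/-- Graph (L¹) distance of `x ∈ ℤ²` from the origin: `|x₁| + |x₂|`. -/
def gnorm (x : ℤ × ℤ) : ℕ := x.1.natAbs + x.2.natAbs

/-- `W n x` is the number of nearest-neighbour walks of length `n` in `ℤ²`
from the origin `o = (0,0)` to `x`, i.e. the number of sequences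
`(v₀, …, v_n)` with `v₀ = o`, `v_n = x` and `|v_{i+1} − v_i| = 1` for all `i`. -/
noncomputable def W (n : ℕ) (x : ℤ × ℤ) : ℕ :=
  Set.ncard {v : Fin (n + 1) → ℤ × ℤ |
    v 0 = (0, 0) ∧ v (Fin.last n) = x ∧
    ∀ i : Fin n, gnorm (v i.succ - v i.castSucc) = 1}

/-- The Green's function `G^{o,x}` of the simple random walk on `ℤ²` with
killing rate `κ`: `G κ x = Σ_{n≥0} (4+κ)^{-n} W_n^{o,x}`. -/
noncomputable def G (κ : ℝ) (x : ℤ × ℤ) : ℝ :=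
  ∑' n : ℕ, (1 / (4 + κ)) ^ n * (W n x : ℝ)

/-- The four unit steps, in rotated coordinates. -/
def ustep (p : Bool × Bool) : ℤ × ℤ :=
  match p with
  | (true, true) => (1, 0)
  | (true, false) => (0, 1)
  | (false, true) => (0, -1)
  | (false, false) => (-1, 0)

lemma ustep_inj : Function.Injective ustep := by decide

lemma gnorm_ustep (p : Bool × Bool) : gnorm (ustep p) = 1 := by
  revert p; decide

lemma exists_ustep (d : ℤ × ℤ) (h : gnorm d = 1) : ∃ p, ustep p = d := by
  obtain ⟨a, b⟩ := d
  simp only [gnorm] at h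
  have : (a = 1 ∧ b = 0) ∨ (a = 0 ∧ b = 1) ∨ (a = 0 ∧ b = -1) ∨ (a = -1 ∧ b = 0) := by omega
  rcases this with ⟨rfl, rfl⟩ | ⟨rfl, rfl⟩ | ⟨rfl, rfl⟩ | ⟨rfl, rfl⟩
  · exact ⟨(true, true), rfl⟩
  · exact ⟨(true, false), rfl⟩
  · exact ⟨(false, true), rfl⟩
  · exact ⟨(false, false), rfl⟩

/-- The walk with given steps. -/
def pathOf {n : ℕ} (f : Fin n → Bool × Bool) : Fin (n + 1) → ℤ × ℤ :=
  Fin.partialSum (fun i => ustep (f i))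

lemma pathOf_zero {n : ℕ} (f : Fin n → Bool × Bool) : pathOf f 0 = 0 := by
  simp [pathOf]

lemma pathOf_succ {n : ℕ} (f : Fin n → Bool × Bool) (i : Fin n) :
    pathOf f i.succ = pathOf f i.castSucc + ustep (f i) := by
  simp [pathOf, Fin.partialSum_succ]

lemma pathOf_last {n : ℕ} (f : Fin n → Bool × Bool) :
    pathOf f (Fin.last n) = ∑ i, ustep (f i) := by
  rw [pathOf, Fin.partialSum, Fin.val_last, List.take_of_length_le (by simp), List.sum_ofFn]

lemma pathOf_inj {n : ℕ} : Function.Injective (pathOf (n := n)) := by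
  intro f g h
  funext i
  apply ustep_inj
  have h1 := pathOf_succ f i
  rw [h, pathOf_succ g i] at h1
  exact (add_left_cancel h1).symm

lemma walk_subset (n : ℕ) (x : ℤ × ℤ) :
    {v : Fin (n + 1) → ℤ × ℤ |
    v 0 = (0, 0) ∧ v (Fin.last n) = x ∧
    ∀ i : Fin n, gnorm (v i.succ - v i.castSucc) = 1} ⊆ Set.range (pathOf (n := n)) := by
  rintro v ⟨h0, -, hs⟩
  choose f hf using fun i => exists_ustep _ (hs i)
  refine ⟨f, ?_⟩
  funext i
  induction i using Fin.induction with
  | zero => rw [pathOf_zero, h0]; rfl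
  | succ i ih => rw [pathOf_succ, ih, hf]; abel

lemma W_le (n : ℕ) (x : ℤ × ℤ) : W n x ≤ 4 ^ n := by
  unfold W
  refine (Set.ncard_le_ncard (walk_subset n x) (Set.finite_range _)).trans ?_
  rw [← Set.image_univ]
  refine (Set.ncard_image_le Set.finite_univ).trans ?_
  simp [Set.ncard_univ]

lemma sum_ustep (N : ℕ) (s t : Finset (Fin (2 * N))) (hs : s.card = N) (ht : t.card = N) :
    ∑ i, ustep (decide (i ∈ s), decide (i ∈ t)) = 0 := by
  have key : ∀ r : Finset (Fin (2 * N)), r.card = N →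
      ∑ i, (if i ∈ r then (1 : ℤ) else -1) = 0 := by
    intro r hr
    have : ∀ i, (if i ∈ r then (1 : ℤ) else -1) = 2 * (if i ∈ r then 1 else 0) - 1 := by
      intro i; split_ifs <;> norm_num
    simp only [this, Finset.sum_sub_distrib, ← Finset.mul_sum]
    simp [hr]
  have e1 : ∀ i, (ustep (decide (i ∈ s), decide (i ∈ t))).1
      + (ustep (decide (i ∈ s), decide (i ∈ t))).2 = (if i ∈ s then (1 : ℤ) else -1) := by
    intro i
    by_cases h1 : i ∈ s <;> by_cases h2 : i ∈ t <;> simp [h1, h2, ustep]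
  have e2 : ∀ i, (ustep (decide (i ∈ s), decide (i ∈ t))).1
      - (ustep (decide (i ∈ s), decide (i ∈ t))).2 = (if i ∈ t then (1 : ℤ) else -1) := by
    intro i
    by_cases h1 : i ∈ s <;> by_cases h2 : i ∈ t <;> simp [h1, h2, ustep]
  have k1 := key s hs
  have k2 := key t ht
  simp only [← e1, Finset.sum_add_distrib] at k1
  simp only [← e2, Finset.sum_sub_distrib] at k2
  apply Prod.ext
  · rw [Prod.fst_sum, Prod.fst_zero]; omega
  · rw [Prod.snd_sum, Prod.snd_zero]; omega

lemma le_W (N : ℕ) : (Nat.centralBinom N) ^ 2 ≤ W (2 * N) (0, 0) := by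
  classical
  let P : Finset (Finset (Fin (2 * N)) × Finset (Fin (2 * N))) :=
    (Finset.powersetCard N Finset.univ) ×ˢ (Finset.powersetCard N Finset.univ)
  have hP : P.card = (Nat.centralBinom N) ^ 2 := by
    simp [P, Finset.card_product, Finset.card_powersetCard, Nat.centralBinom, sq]
  rw [← hP, ← Set.ncard_coe_finset]
  unfold W
  refine Set.ncard_le_ncard_of_injOn
    (fun q => pathOf (fun i => (decide (i ∈ q.1), decide (i ∈ q.2)))) ?_ ?_
    ((Set.finite_range _).subset (walk_subset _ _))
  · rintro ⟨s, t⟩ h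
    simp only [P, Finset.mem_product, Finset.mem_powersetCard, Finset.coe_product,
      Set.mem_prod, Finset.mem_coe, Finset.subset_univ, true_and] at h
    refine ⟨pathOf_zero _, ?_, ?_⟩
    · rw [pathOf_last]; exact sum_ustep N s t h.1 h.2
    · intro i
      rw [pathOf_succ, add_sub_cancel_left]; exact gnorm_ustep _
  · rintro ⟨s, t⟩ - ⟨s', t'⟩ - h
    have h2 := pathOf_inj h
    apply Prod.ext
    · ext i
      have := congrFun h2 i
      simp only [Prod.mk.injEq, decide_eq_decide] at this
      exact this.1
    · ext i
      have := congrFun h2 i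
      simp only [Prod.mk.injEq, decide_eq_decide] at this
      exact this.2

lemma central_bound (n : ℕ) : (16 : ℝ) ^ (n + 1) ≤ 4 * (n + 1) * (Nat.centralBinom (n + 1) : ℝ) ^ 2 := by
  induction n with
  | zero => norm_num [Nat.centralBinom, Nat.choose]
  | succ n ih =>
    have h := Nat.succ_mul_centralBinom_succ (n + 1)
    have h' : ((n : ℝ) + 2) * (Nat.centralBinom (n + 2) : ℝ)
        = 2 * (2 * (n + 1) + 1) * (Nat.centralBinom (n + 1) : ℝ) := by
      have : (((n + 1 + 1) * Nat.centralBinom (n + 1 + 1) : ℕ) : ℝ)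
        = ((2 * (2 * (n + 1) + 1) * Nat.centralBinom (n + 1) : ℕ) : ℝ) := by exact_mod_cast h
      push_cast at this
      linarith
    set a := (Nat.centralBinom (n + 1) : ℝ)
    have hx : (0 : ℝ) ≤ n := Nat.cast_nonneg n
    have hb : (Nat.centralBinom (n + 1 + 1) : ℝ) = 2 * (2 * (n + 1) + 1) * a / (n + 2) := by
      rw [eq_div_iff (by positivity), mul_comm]; exact h'
    rw [hb, pow_succ]
    have : (4 * (((n + 1 : ℕ) : ℝ) + 1) * (2 * (2 * (n + 1) + 1) * a / (n + 2)) ^ 2)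
        = 16 * (2 * n + 3) ^ 2 * a ^ 2 / (n + 2) := by
      push_cast; field_simp; ring
    rw [this, le_div_iff₀ (by positivity)]
    have h3 : (16 : ℝ) ^ (n + 1) * 16 * (n + 2) ≤ 4 * (n + 1) * a ^ 2 * 16 * (n + 2) := by gcongr
    refine h3.trans ?_
    nlinarith [sq_nonneg a]

lemma G_summable (κ : ℝ) (hκ : 0 < κ) (x : ℤ × ℤ) :
    Summable (fun n : ℕ => (1 / (4 + κ)) ^ n * (W n x : ℝ)) := by
  refine Summable.of_nonneg_of_le (fun n => by positivity) (fun n => ?_)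
    (summable_geometric_of_lt_one (r := 4 / (4 + κ)) (by positivity)
      ((div_lt_one (by positivity)).2 (by linarith)))
  have : (W n x : ℝ) ≤ 4 ^ n := by exact_mod_cast W_le n x
  calc (1 / (4 + κ)) ^ n * (W n x : ℝ) ≤ (1 / (4 + κ)) ^ n * 4 ^ n := by gcongr
    _ = (4 / (4 + κ)) ^ n := by rw [← mul_pow]; congr 1; ring

lemma term_bound (κ : ℝ) (hκ : 0 < κ) (n : ℕ) (hn : ((n : ℝ) + 1) * κ ≤ 1) :
    (1 / 8 : ℝ) * ((n : ℝ) + 1)⁻¹ ≤ (1 / (4 + κ)) ^ (2 * (n + 1)) * (W (2 * (n + 1)) (0, 0) : ℝ) := by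
  have h1 : (Nat.centralBinom (n + 1) : ℝ) ^ 2 ≤ W (2 * (n + 1)) (0, 0) := by
    exact_mod_cast le_W (n + 1)
  have h2 := central_bound n
  have hx : (0 : ℝ) ≤ n := Nat.cast_nonneg n
  have h3 : (1 / 2 : ℝ) ≤ (4 / (4 + κ)) ^ (2 * (n + 1)) := by
    have hb : 1 - κ / 4 ≤ 4 / (4 + κ) := by
      rw [le_div_iff₀ (by positivity)]; nlinarith
    have hk1 : κ ≤ 1 := by nlinarith
    have hber := one_add_mul_le_pow (a := -(κ / 4)) (by linarith) (2 * (n + 1))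
    push_cast at hber
    calc (1 / 2 : ℝ) ≤ 1 + 2 * ((n : ℝ) + 1) * -(κ / 4) := by nlinarith
      _ ≤ (1 + -(κ / 4)) ^ (2 * (n + 1)) := hber
      _ ≤ _ := pow_le_pow_left₀ (by linarith) (by linarith) _
  have h4 : (4 / (4 + κ)) ^ (2 * (n + 1)) = (1 / (4 + κ)) ^ (2 * (n + 1)) * 16 ^ (n + 1) := by
    have : (16 : ℝ) ^ (n + 1) = 4 ^ (2 * (n + 1)) := by rw [pow_mul]; norm_num
    rw [this, ← mul_pow]; congr 1; ring
  set q := (1 / (4 + κ)) ^ (2 * (n + 1)) with hq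
  have hq0 : 0 ≤ q := by positivity
  have h5 : (1 / 2 : ℝ) ≤ q * (4 * (n + 1) * (W (2 * (n + 1)) (0, 0) : ℝ)) := by
    rw [h4] at h3
    refine h3.trans (mul_le_mul_of_nonneg_left (h2.trans ?_) hq0)
    gcongr
  rw [← div_eq_mul_inv, div_le_iff₀ (by positivity)]
  linarith

lemma G_lower (κ : ℝ) (hκ : 0 < κ) : Real.log κ⁻¹ / 8 ≤ G κ (0, 0) := by
  set N := ⌊κ⁻¹⌋₊ with hN
  have hs := G_summable κ hκ (0, 0)
  have hinj : Function.Injective (fun n : ℕ => 2 * (n + 1)) := fun a b h => by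
    simp only at h; omega
  have h1 : ∑ n ∈ (Finset.range N).map ⟨_, hinj⟩, (1 / (4 + κ)) ^ n * (W n (0, 0) : ℝ) ≤ G κ (0, 0) :=
    hs.sum_le_tsum _ (fun n _ => by positivity)
  rw [Finset.sum_map] at h1
  refine le_trans ?_ h1
  have h2 : ∑ n ∈ Finset.range N, (1 / 8 : ℝ) * ((n : ℝ) + 1)⁻¹ ≤
      ∑ n ∈ Finset.range N, (1 / (4 + κ)) ^ (2 * (n + 1)) * (W (2 * (n + 1)) (0, 0) : ℝ) := by
    refine Finset.sum_le_sum (fun n hn => term_bound κ hκ n ?_)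
    have hn' : n + 1 ≤ N := Finset.mem_range.1 hn
    have : ((n + 1 : ℕ) : ℝ) ≤ κ⁻¹ := (Nat.le_floor_iff (by positivity)).1 hn'
    push_cast at this
    calc ((n : ℝ) + 1) * κ ≤ κ⁻¹ * κ := by gcongr
      _ = 1 := inv_mul_cancel₀ hκ.ne'
  refine le_trans ?_ h2
  rw [← Finset.mul_sum]
  have h3 := log_add_one_le_harmonic N
  have h4 : ((harmonic N : ℚ) : ℝ) = ∑ n ∈ Finset.range N, ((n : ℝ) + 1)⁻¹ := by
    simp [harmonic]
  rw [h4] at h3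
  have h5 : Real.log κ⁻¹ ≤ Real.log ((N + 1 : ℕ) : ℝ) := by
    apply Real.log_le_log (by positivity)
    push_cast
    exact (Nat.lt_floor_add_one _).le
  push_cast at h5 h3
  linarith

/-- Lemma 5.3: for `m` large and `exp(e^{32}) ≤ κ⁻¹ ≤ m^{1 − 8/(log log m)}`,
one has `κ⁻¹ ≤ m^{1 − 6/(log G^{o,o})}`. -/
theorem stmt17 :
    ∃ m₀ : ℝ, Real.exp (Real.exp 1) < m₀ ∧
      ∀ m : ℝ, m₀ ≤ m → ∀ κ : ℝ, 0 < κ →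
        Real.exp (Real.exp 32) ≤ κ⁻¹ →
        κ⁻¹ ≤ m ^ (1 - 8 / Real.log (Real.log m)) →
        κ⁻¹ ≤ m ^ (1 - 6 / Real.log (G κ (0, 0))) := by
  refine ⟨Real.exp (Real.exp 2), by gcongr; norm_num, ?_⟩
  intro m hm κ hκ h32 hK
  have hG := G_lower κ hκ
  have hm0 : 0 < m := (Real.exp_pos _).trans_le hm
  have hM : Real.exp 2 ≤ Real.log m := (Real.le_log_iff_exp_le hm0).2 hm
  have hK0 : 0 < κ⁻¹ := by positivity
  have hL : Real.exp 32 ≤ Real.log κ⁻¹ := (Real.le_log_iff_exp_le hK0).2 h32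
  rw [← Real.log_le_log_iff hK0 (by positivity), Real.log_rpow hm0] at hK ⊢
  set L := Real.log κ⁻¹
  set M := Real.log m
  have hM0 : 0 < M := (Real.exp_pos _).trans_le hM
  have hL0 : 0 < L := (Real.exp_pos _).trans_le hL
  have hl2 : 2 ≤ Real.log M := (Real.le_log_iff_exp_le hM0).2 hM
  have hLM : L ≤ M := by
    have : 0 ≤ 8 / Real.log M := by positivity
    nlinarith
  have hl32 : 32 ≤ Real.log L := (Real.le_log_iff_exp_le hL0).2 hL
  have hlog8 : Real.log 8 ≤ 3 := by
    have : (8 : ℝ) = 2 ^ 3 := by norm_num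
    rw [this, Real.log_pow]
    have := Real.log_two_lt_d9
    push_cast; linarith
  have hg : Real.log L - 3 ≤ Real.log (G κ (0, 0)) := by
    have := Real.log_le_log (by positivity) hG
    rw [Real.log_div hL0.ne' (by norm_num)] at this
    linarith
  set g := Real.log (G κ (0, 0))
  have hg0 : 29 ≤ g := by linarith
  have hlLM : Real.log L ≤ Real.log M := Real.log_le_log hL0 hLM
  by_cases hc : L ≤ M / 2
  · have : 6 / g ≤ 1 / 2 := by
      rw [div_le_iff₀ (by linarith)]; linarith
    nlinarith
  · push Not at hc
    have h1 : Real.log M - Real.log 2 ≤ Real.log L := by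
      rw [← Real.log_div hM0.ne' (by norm_num)]
      exact Real.log_le_log (by positivity) hc.le
    have h2 := Real.log_two_lt_d9
    have h3 : 6 / g ≤ 8 / Real.log M := by
      rw [div_le_div_iff₀ (by linarith) (by linarith)]; linarith
    refine hK.trans ?_
    rw [mul_comm, mul_comm _ M]
    nlinarith
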